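/- Bisimulation equivalence of spans of pure lenses from A to B is an equivalence relation: (reflexivity) sp ≡b sp for every span sp; (symmetry) if sp1 ≡b sp2 then sp2 ≡b sp1; (transitivity) if sp1 ≡b sp2 and sp2 ≡b sp3 then sp1 ≡b sp3, where sp1, sp2, sp3 may have arbitrary (possibly different) state types. -/

import Mathlib

universe u

structure Lens (A B : Type u) where
  get : A → B
  put : A → B → A
  create : B → A

/-- A span of pure lenses from `A` to `B`, packaged with its state type. -/
structure PSpan (A B : Type u) where
  S : Type u
  left : Lens S A
  right : Lens S B

/-- `f` is a base map from `l1` to `l2` (pure case). -/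
def IsBaseMap {T1 T2 V : Type u} (l1 : Lens T1 V) (l2 : Lens T2 V)
    (f : T1 → T2) : Prop :=
  (∀ t, l1.get t = l2.get (f t)) ∧
  (∀ t v, f (l1.put t v) = l2.put (f t) v) ∧
  (∀ v, f (l1.create v) = l2.create v)

/-- Bisimulation equivalence of spans of pure lenses. -/
def PSpan.BisimEquiv {A B : Type u} (sp1 sp2 : PSpan A B) : Prop :=
  ∃ (R : Set (sp1.S × sp2.S))
    (lft : Lens {p : sp1.S × sp2.S // p ∈ R} A)
    (rgt : Lens {p : sp1.S × sp2.S // p ∈ R} B),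
    IsBaseMap lft sp1.left (fun p => p.val.1) ∧
    IsBaseMap rgt sp1.right (fun p => p.val.1) ∧
    IsBaseMap lft sp2.left (fun p => p.val.2) ∧
    IsBaseMap rgt sp2.right (fun p => p.val.2)

/-- A relation compatible with the operations of two lenses on the same view. -/
def LensRel {S T V : Type u} (R : S → T → Prop) (l1 : Lens S V) (l2 : Lens T V) : Prop :=
  (∀ s t, R s t → l1.get s = l2.get t) ∧
  (∀ s t v, R s t → R (l1.put s v) (l2.put t v)) ∧
  (∀ v, R (l1.create v) (l2.create v))

theorem LensRel.of_baseMaps {S T V : Type u} {R : Set (S × T)}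
    {l : Lens {p : S × T // p ∈ R} V} {l1 : Lens S V} {l2 : Lens T V}
    (h1 : IsBaseMap l l1 (fun p => p.val.1)) (h2 : IsBaseMap l l2 (fun p => p.val.2)) :
    LensRel (fun s t => (s, t) ∈ R) l1 l2 := by
  obtain ⟨g1, p1, c1⟩ := h1
  obtain ⟨g2, p2, c2⟩ := h2
  refine ⟨fun s t h => ?_, fun s t v h => ?_, fun v => ?_⟩
  · exact (g1 ⟨(s, t), h⟩).symm.trans (g2 ⟨(s, t), h⟩)
  · have e1 := p1 ⟨(s, t), h⟩ v
    have e2 := p2 ⟨(s, t), h⟩ v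
    dsimp only at e1 e2 ⊢
    rw [← e1, ← e2]
    exact (l.put ⟨(s, t), h⟩ v).property
  · have e1 := c1 v
    have e2 := c2 v
    dsimp only at e1 e2 ⊢
    rw [← e1, ← e2]
    exact (l.create v).property

theorem LensRel.exists_lens {S T V : Type u} {R : S → T → Prop}
    {l1 : Lens S V} {l2 : Lens T V} (h : LensRel R l1 l2) :
    ∃ l : Lens {p : S × T // p ∈ {q : S × T | R q.1 q.2}} V,
      IsBaseMap l l1 (fun p => p.val.1) ∧ IsBaseMap l l2 (fun p => p.val.2) :=
  ⟨{ get := fun p => l1.get p.val.1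
     put := fun p v => ⟨(l1.put p.val.1 v, l2.put p.val.2 v), h.2.1 _ _ v p.property⟩
     create := fun v => ⟨(l1.create v, l2.create v), h.2.2 v⟩ },
    ⟨fun _ => rfl, fun _ _ => rfl, fun _ => rfl⟩,
    ⟨fun p => h.1 _ _ p.property, fun _ _ => rfl, fun _ => rfl⟩⟩

theorem bisimEquiv_iff {A B : Type u} (sp1 sp2 : PSpan A B) :
    sp1.BisimEquiv sp2 ↔ ∃ R : sp1.S → sp2.S → Prop,
      LensRel R sp1.left sp2.left ∧ LensRel R sp1.right sp2.right := by
  constructor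
  · rintro ⟨R, lft, rgt, a, b, c, d⟩
    exact ⟨_, .of_baseMaps a c, .of_baseMaps b d⟩
  · rintro ⟨R, hl, hr⟩
    obtain ⟨lft, a, c⟩ := hl.exists_lens
    obtain ⟨rgt, b, d⟩ := hr.exists_lens
    exact ⟨_, lft, rgt, a, b, c, d⟩

theorem LensRel.refl {S V : Type u} (l : Lens S V) : LensRel Eq l l :=
  ⟨fun _ _ h => h ▸ rfl, fun _ _ _ h => h ▸ rfl, fun _ => rfl⟩

theorem LensRel.swap {S T V : Type u} {R : S → T → Prop} {l1 : Lens S V} {l2 : Lens T V}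
    (h : LensRel R l1 l2) : LensRel (fun t s => R s t) l2 l1 :=
  ⟨fun _ _ r => (h.1 _ _ r).symm, fun _ _ v r => h.2.1 _ _ v r, h.2.2⟩

theorem LensRel.comp {S T U V : Type u} {R : S → T → Prop} {Q : T → U → Prop}
    {l1 : Lens S V} {l2 : Lens T V} {l3 : Lens U V}
    (h : LensRel R l1 l2) (k : LensRel Q l2 l3) :
    LensRel (fun s w => ∃ t, R s t ∧ Q t w) l1 l3 :=
  ⟨fun _ _ ⟨_, r, q⟩ => (h.1 _ _ r).trans (k.1 _ _ q),
    fun _ _ v ⟨_, r, q⟩ => ⟨_, h.2.1 _ _ v r, k.2.1 _ _ v q⟩,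
    fun v => ⟨_, h.2.2 v, k.2.2 v⟩⟩

/-- bisimulation equivalence of spans of pure lenses is reflexive,
symmetric and transitive. -/
theorem bisimEquiv_is_equivalence {A B : Type u} :
    (∀ sp : PSpan A B, sp.BisimEquiv sp) ∧
    (∀ sp1 sp2 : PSpan A B, sp1.BisimEquiv sp2 → sp2.BisimEquiv sp1) ∧
    (∀ sp1 sp2 sp3 : PSpan A B,
      sp1.BisimEquiv sp2 → sp2.BisimEquiv sp3 → sp1.BisimEquiv sp3) := by
  simp only [bisimEquiv_iff]
  refine ⟨fun sp => ⟨Eq, .refl _, .refl _⟩, ?_, ?_⟩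
  · rintro sp1 sp2 ⟨R, hl, hr⟩
    exact ⟨_, hl.swap, hr.swap⟩
  · rintro sp1 sp2 sp3 ⟨R, hl, hr⟩ ⟨Q, kl, kr⟩
    exact ⟨_, hl.comp kl, hr.comp kr⟩
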